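/- arXiv:2406.19022 — 6 statements merged into one kernel-verified Lean document; each statement's English description precedes it below -/
import Mathlib

section
/- Let $N$ and $t$ be integers with $1 \le t$ and $2t \le N$, and define $F(N,t) = \binom{N}{\lceil N/2 \rceil + t} \cdot \sum_{i=0}^{t} \binom{N}{\lceil N/2 \rceil + i}^{-1}$ (as a real number). Then $F(N,t) \le 1 + \min\{t, N/t\}$. -/
/-- Consecutive binomial coefficients above the middle satisfy
`C(N, M+t+1) * (N+2t+2) ≤ C(N, M+t) * (N-2t)`, where `M = ⌈N/2⌉`. -/
theorem choose_above_middle_succ_mul_le (N t : ℕ) (h : 2 * t ≤ N) :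
    (N.choose ((N + 1) / 2 + (t + 1)) : ℝ) * (N + 2 * t + 2) ≤
      N.choose ((N + 1) / 2 + t) * (N - 2 * t) := by
  have hM : N ≤ 2 * ((N + 1) / 2) := by omega
  have hle : (N + 1) / 2 + t ≤ N := by omega
  have e := Nat.choose_succ_right_eq N ((N + 1) / 2 + t)
  rw [add_assoc] at e
  generalize (N + 1) / 2 = M at *
  have e' : (N.choose (M + (t + 1)) : ℝ) * (M + (t + 1)) =
      N.choose (M + t) * (N - (M + t)) := by
    have := congrArg (Nat.cast (R := ℝ)) e
    push_cast [Nat.cast_sub hle] at this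
    exact this
  have hM' : (N : ℝ) ≤ 2 * M := by exact_mod_cast hM
  have h1 := mul_le_mul_of_nonneg_left hM' (Nat.cast_nonneg (α := ℝ) (N.choose (M + (t + 1))))
  have h2 := mul_le_mul_of_nonneg_left hM' (Nat.cast_nonneg (α := ℝ) (N.choose (M + t)))
  nlinarith

/-- The quantity `F(N,t)` satisfies `(N+2t+2) (F(N,t+1) - 1) ≤ (N-2t) F(N,t)`. -/
theorem choose_mul_sum_inv_choose_succ_le (N t : ℕ) (h : 2 * (t + 1) ≤ N) :
    ((N : ℝ) + 2 * t + 2) * ((N.choose ((N + 1) / 2 + (t + 1)) : ℝ) *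
        ∑ i ∈ Finset.range (t + 1 + 1), ((N.choose ((N + 1) / 2 + i) : ℝ))⁻¹ - 1) ≤
      (N - 2 * t) * ((N.choose ((N + 1) / 2 + t) : ℝ) *
        ∑ i ∈ Finset.range (t + 1), ((N.choose ((N + 1) / 2 + i) : ℝ))⁻¹) := by
  have hpos : (N.choose ((N + 1) / 2 + (t + 1)) : ℝ) ≠ 0 := by
    exact_mod_cast (Nat.choose_pos (by omega)).ne'
  have hS : 0 ≤ ∑ i ∈ Finset.range (t + 1), ((N.choose ((N + 1) / 2 + i) : ℝ))⁻¹ :=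
    Finset.sum_nonneg fun i _ => by positivity
  have hc := mul_le_mul_of_nonneg_right (choose_above_middle_succ_mul_le N t (by omega)) hS
  rw [Finset.sum_range_succ _ (t + 1), mul_add, mul_inv_cancel₀ hpos]
  linarith

theorem choose_mul_sum_inv_choose_le_one_add (N t : ℕ) (h : 2 * t ≤ N) :
    (N.choose ((N + 1) / 2 + t) : ℝ) *
        ∑ i ∈ Finset.range (t + 1), ((N.choose ((N + 1) / 2 + i) : ℝ))⁻¹ ≤ 1 + t := by
  induction t with
  | zero => simpa using mul_inv_le_one
  | succ t ih =>
    have hr := choose_mul_sum_inv_choose_succ_le N t h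
    have hb := ih (by omega)
    have hN : (2 : ℝ) * (t + 1) ≤ N := by exact_mod_cast h
    have ht : (0 : ℝ) ≤ t := t.cast_nonneg
    have hm := mul_le_mul_of_nonneg_left hb (show (0 : ℝ) ≤ N - 2 * t by linarith)
    push_cast
    refine le_of_mul_le_mul_left (a := (N : ℝ) + 2 * t + 2) ?_ (by linarith)
    nlinarith

theorem choose_mul_sum_inv_choose_le_one_add_div (N t : ℕ) (ht : 1 ≤ t) (h : 2 * t ≤ N) :
    (N.choose ((N + 1) / 2 + t) : ℝ) *
        ∑ i ∈ Finset.range (t + 1), ((N.choose ((N + 1) / 2 + i) : ℝ))⁻¹ ≤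
      1 + (N : ℝ) / t := by
  induction t, ht using Nat.le_induction with
  | base =>
    have h1 := choose_mul_sum_inv_choose_le_one_add N 1 h
    have hN : (2 : ℝ) ≤ N := by exact_mod_cast h
    push_cast at h1 ⊢
    linarith
  | succ t ht ih =>
    have ht' : (1 : ℝ) ≤ t := by exact_mod_cast ht
    by_cases hsq : (t + 1) * (t + 1) ≤ N
    · refine (choose_mul_sum_inv_choose_le_one_add N (t + 1) h).trans ?_
      have hsq' : ((t : ℝ) + 1) * (t + 1) ≤ N := by exact_mod_cast hsq
      push_cast
      gcongr
      rwa [le_div_iff₀ (by positivity)]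
    · have hr := choose_mul_sum_inv_choose_succ_le N t h
      have hN : (2 : ℝ) * (t + 1) ≤ N := by exact_mod_cast h
      have hsq' : (N : ℝ) ≤ (t + 1) * (t + 1) := by exact_mod_cast (not_le.mp hsq).le
      have hm := mul_le_mul_of_nonneg_left (ih (by omega)) (show (0 : ℝ) ≤ N - 2 * t by linarith)
      have key : ((N : ℝ) - 2 * t) * (1 + N / t) ≤ (N + 2 * t + 2) * (N / (t + 1)) := by
        rw [← sub_nonneg]
        have : ((N : ℝ) + 2 * t + 2) * (N / (t + 1)) - (N - 2 * t) * (1 + N / t) =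
            (N * (3 * t * (t + 1) - N) + 2 * t ^ 2 * (t + 1)) / (t * (t + 1)) := by
          field_simp
          ring
        rw [this]
        have : (0 : ℝ) ≤ 3 * t * (t + 1) - N := by nlinarith
        positivity
      push_cast
      refine le_of_mul_le_mul_left (a := (N : ℝ) + 2 * t + 2) ?_ (by linarith)
      linarith

/-- Claim 2.2 (`F(N,t) ≤ 1 + min{t, N/t}`): for integers `N, t` with `1 ≤ t` and
`2t ≤ N`, with `⌈N/2⌉ = (N+1)/2`,
`C(N, ⌈N/2⌉+t) * ∑_{i=0}^{t} C(N, ⌈N/2⌉+i)⁻¹ ≤ 1 + min (t, N/t)`. -/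
theorem permutation_complex_F_bound (N t : ℕ) (ht : 1 ≤ t) (hN : 2 * t ≤ N) :
    (N.choose ((N + 1) / 2 + t) : ℝ) *
        ∑ i ∈ Finset.range (t + 1), ((N.choose ((N + 1) / 2 + i) : ℝ))⁻¹
      ≤ 1 + min (t : ℝ) ((N : ℝ) / (t : ℝ)) := by
  rw [← min_add_add_left]
  exact le_min (choose_mul_sum_inv_choose_le_one_add N t hN)
    (choose_mul_sum_inv_choose_le_one_add_div N t ht hN)
end

section
/- For all integers $\ell \ge 0$ and $j \ge 0$, $\binom{2\ell+j}{\ell+j} \cdot \sum_{i=0}^{j} \binom{2\ell+j}{\ell+i}^{-1} \le \frac{10(\ell+j+1)}{j+1}$. -/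
/-- The reciprocals of two adjacent binomial coefficients add up to a multiple of the reciprocal of
the binomial coefficient above them in Pascal's triangle. -/
theorem inv_choose_succ_add_inv_choose_succ_succ {n m : ℕ} (h : m ≤ n) :
    ((n + 1).choose m : ℝ)⁻¹ + ((n + 1).choose (m + 1) : ℝ)⁻¹
      = (n + 2) / (n + 1) * (n.choose m : ℝ)⁻¹ := by
  have h₀ : (0 : ℝ) < n.choose m := by exact_mod_cast Nat.choose_pos h
  have h₁ : (0 : ℝ) < (n + 1).choose m := by exact_mod_cast Nat.choose_pos (by omega)
  have h₂ : (0 : ℝ) < (n + 1).choose (m + 1) := by exact_mod_cast Nat.choose_pos (by omega)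
  have e₁ : (n.choose m : ℝ) * (n + 1) = (n + 1).choose m * (n + 1 - m) := by
    have := congrArg (Nat.cast (R := ℝ)) (Nat.choose_mul_succ_eq n m)
    rw [Nat.cast_mul, Nat.cast_mul, Nat.cast_sub (by omega)] at this
    simpa using this
  have e₂ : ((n : ℝ) + 1) * n.choose m = (n + 1).choose (m + 1) * (m + 1) := by
    exact_mod_cast Nat.add_one_mul_choose_eq n m
  have i₁ : ((n + 1).choose m : ℝ)⁻¹ = (n + 1 - m) / ((n + 1) * n.choose m) := by
    field_simp
    linarith
  have i₂ : ((n + 1).choose (m + 1) : ℝ)⁻¹ = (m + 1) / ((n + 1) * n.choose m) := by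
    field_simp
    linarith
  rw [i₁, i₂]
  field_simp
  ring

/-- Recurrence in `j` for the normalized sum of reciprocals of the central binomial coefficients. -/
theorem choose_mul_sum_inv_choose_succ (ℓ j : ℕ) :
    ((2 * ℓ + (j + 1)).choose (ℓ + (j + 1)) : ℝ) *
        ∑ i ∈ Finset.range (j + 1 + 1), ((2 * ℓ + (j + 1)).choose (ℓ + i) : ℝ)⁻¹
      = 1 + (2 * ℓ + j + 2) / (2 * (ℓ + j + 1)) *
        (((2 * ℓ + j).choose (ℓ + j) : ℝ) *
          ∑ i ∈ Finset.range (j + 1), ((2 * ℓ + j).choose (ℓ + i) : ℝ)⁻¹) := by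
  set f : ℕ → ℝ := fun i ↦ ((2 * ℓ + (j + 1)).choose (ℓ + i) : ℝ)⁻¹ with hf
  set T := ∑ i ∈ Finset.range (j + 1), ((2 * ℓ + j).choose (ℓ + i) : ℝ)⁻¹ with hT
  have hC : (0 : ℝ) < (2 * ℓ + (j + 1)).choose (ℓ + (j + 1)) := by
    exact_mod_cast Nat.choose_pos (by omega)
  have hsymm : f 0 = f (j + 1) := by
    simp only [hf]
    rw [← Nat.choose_symm_of_eq_add (show 2 * ℓ + (j + 1) = (ℓ + 0) + (ℓ + (j + 1)) by ring)]
  have hsum : ∑ i ∈ Finset.range (j + 1), (f i + f (i + 1))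
      = (2 * ℓ + j + 2) / (2 * ℓ + j + 1) * T := by
    rw [hT, Finset.mul_sum]
    refine Finset.sum_congr rfl fun i hi ↦ ?_
    have := inv_choose_succ_add_inv_choose_succ_succ (n := 2 * ℓ + j) (m := ℓ + i)
      (by have := Finset.mem_range.mp hi; omega)
    push_cast at this
    exact this
  rw [Finset.sum_add_distrib] at hsum
  have hlast := Finset.sum_range_succ f (j + 1)
  have hfirst := Finset.sum_range_succ' f (j + 1)
  have hchoose : ((2 * ℓ + j + 1 : ℝ)) * (2 * ℓ + j).choose (ℓ + j)
      = (2 * ℓ + (j + 1)).choose (ℓ + (j + 1)) * (ℓ + j + 1) := by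
    exact_mod_cast Nat.add_one_mul_choose_eq (2 * ℓ + j) (ℓ + j)
  have hone : ((2 * ℓ + (j + 1)).choose (ℓ + (j + 1)) : ℝ) * f (j + 1) = 1 :=
    mul_inv_cancel₀ hC.ne'
  have hS : ∑ i ∈ Finset.range (j + 1 + 1), f i
      = f (j + 1) + (2 * ℓ + j + 2) / (2 * ℓ + j + 1) * T / 2 := by
    linarith
  rw [hS, mul_add, hone]
  have hc : ((2 * ℓ + j).choose (ℓ + j) : ℝ)
      = (2 * ℓ + (j + 1)).choose (ℓ + (j + 1)) * (ℓ + j + 1) / (2 * ℓ + j + 1) := by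
    rw [← hchoose]
    field_simp
  rw [hc]
  field_simp

/-- The rational function below is a supersolution of the recurrence
`choose_mul_sum_inv_choose_succ`. -/
theorem one_add_mul_le_of_nonneg {x y : ℝ} (hx : 0 ≤ x) (hy : 0 ≤ y) :
    1 + (2 * x + y + 2) / (2 * (x + y + 1)) *
        (8 * (x + y + 1) * (y + 1) / ((y + 1) ^ 2 + 4 * x + 4))
      ≤ 8 * (x + (y + 1) + 1) * (y + 1 + 1) / ((y + 1 + 1) ^ 2 + 4 * x + 4) := by
  have h : (2 * x + y + 2) / (2 * (x + y + 1)) *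
        (8 * (x + y + 1) * (y + 1) / ((y + 1) ^ 2 + 4 * x + 4))
      = 4 * (2 * x + y + 2) * (y + 1) / ((y + 1) ^ 2 + 4 * x + 4) := by
    field_simp
    ring
  rw [h, ← sub_nonneg]
  have : 8 * (x + (y + 1) + 1) * (y + 1 + 1) / ((y + 1 + 1) ^ 2 + 4 * x + 4) -
      (1 + 4 * (2 * x + y + 2) * (y + 1) / ((y + 1) ^ 2 + 4 * x + 4))
      = (8 * (x + (y + 1) + 1) * (y + 1 + 1) * ((y + 1) ^ 2 + 4 * x + 4)
        - ((y + 1 + 1) ^ 2 + 4 * x + 4) * ((y + 1) ^ 2 + 4 * x + 4)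
        - 4 * (2 * x + y + 2) * (y + 1) * ((y + 1 + 1) ^ 2 + 4 * x + 4))
        / (((y + 1 + 1) ^ 2 + 4 * x + 4) * ((y + 1) ^ 2 + 4 * x + 4)) := by
    field_simp
    ring
  rw [this]
  apply div_nonneg _ (by positivity)
  ring_nf
  positivity

theorem choose_mul_sum_inv_choose_le (ℓ j : ℕ) :
    ((2 * ℓ + j).choose (ℓ + j) : ℝ) *
        ∑ i ∈ Finset.range (j + 1), ((2 * ℓ + j).choose (ℓ + i) : ℝ)⁻¹
      ≤ 8 * (ℓ + j + 1) * (j + 1) / ((j + 1) ^ 2 + 4 * ℓ + 4) := by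
  induction j with
  | zero =>
    have hC : (0 : ℝ) < (2 * ℓ).choose ℓ := by exact_mod_cast Nat.choose_pos (by omega)
    simp only [add_zero, zero_add, Finset.range_one, Finset.sum_singleton, Nat.cast_zero]
    rw [mul_inv_cancel₀ hC.ne', le_div_iff₀ (by positivity)]
    linarith [(Nat.cast_nonneg ℓ : (0 : ℝ) ≤ ℓ)]
  | succ j ih =>
    rw [choose_mul_sum_inv_choose_succ]
    push_cast
    refine le_trans ?_ (one_add_mul_le_of_nonneg (Nat.cast_nonneg ℓ) (Nat.cast_nonneg j))
    gcongr

/-- Corollary 2.3: for all integers `ℓ, j ≥ 0`,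
`C(2ℓ+j, ℓ+j) * ∑_{i=0}^{j} C(2ℓ+j, ℓ+i)⁻¹ ≤ 10(ℓ+j+1)/(j+1)`. -/
theorem permutation_complex_corollary_binom_sum (ℓ j : ℕ) :
    ((2 * ℓ + j).choose (ℓ + j) : ℝ) *
        ∑ i ∈ Finset.range (j + 1), (((2 * ℓ + j).choose (ℓ + i) : ℝ))⁻¹
      ≤ 10 * ((ℓ : ℝ) + (j : ℝ) + 1) / ((j : ℝ) + 1) := by
  refine (choose_mul_sum_inv_choose_le ℓ j).trans ?_
  rw [div_le_div_iff₀ (by positivity) (by positivity), ← sub_nonneg]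
  ring_nf
  positivity
end

section
/- For all integers $N \ge 1$, $t \ge 0$ and $i$ with $0 \le i \le t$ and $2t \le N$, one has $\binom{N}{\lceil N/2 \rceil + t} \le \binom{N}{\lceil N/2 \rceil + i} \cdot \exp\!\left(\frac{i^2 - t^2}{N}\right)$, where the inequality is between real numbers. -/
/-- One step to the right of the middle, the binomial coefficients decay by a Gaussian factor. -/
theorem choose_half_add_succ_le (N k : ℕ) (hk : 2 * (k + 1) ≤ N) :
    (N.choose ((N + 1) / 2 + (k + 1)) : ℝ)
      ≤ (N.choose ((N + 1) / 2 + k) : ℝ) * Real.exp (-(2 * k + 1) / N) := by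
  obtain ⟨h, hh⟩ : ∃ h, h = (N + 1) / 2 := ⟨_, rfl⟩
  rw [← hh, ← add_assoc]
  have hd : h + k + 1 ≤ N := by omega
  have hh2 : N ≤ 2 * h := by omega
  have hN : (0 : ℝ) < N := by exact_mod_cast (by omega : 0 < N)
  have hrec : (N.choose (h + k + 1) : ℝ) * (h + k + 1) = N.choose (h + k) * (N - (h + k)) := by
    have := congrArg (Nat.cast (R := ℝ)) (Nat.choose_succ_right_eq N (h + k))
    rw [Nat.cast_mul, Nat.cast_mul, Nat.cast_sub (by omega)] at this
    exact_mod_cast this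
  have hexp : 1 - (2 * k + 1) / (N : ℝ) ≤ Real.exp (-(2 * k + 1) / N) := by
    have := Real.add_one_le_exp (-(2 * k + 1) / (N : ℝ))
    rw [neg_div] at this ⊢
    linarith
  have hratio : (N : ℝ) - (h + k) ≤ (1 - (2 * k + 1) / N) * (h + k + 1) := by
    have hdR : (h : ℝ) + k + 1 ≤ N := by exact_mod_cast hd
    have hhR : (N : ℝ) ≤ 2 * h := by exact_mod_cast hh2
    have hle : (2 * k + 1) / (N : ℝ) * (h + k + 1) ≤ 2 * k + 1 := by
      rw [div_mul_eq_mul_div, div_le_iff₀ hN]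
      gcongr
    linarith
  have hpos : (0 : ℝ) < h + k + 1 := by positivity
  refine le_of_mul_le_mul_right ?_ hpos
  rw [hrec, mul_assoc]
  gcongr
  exact hratio.trans (by gcongr)

/-- Inequality (2) from Claim 2.2: for `0 ≤ i ≤ t`, `2t ≤ N`, `N ≥ 1`,
`C(N, ⌈N/2⌉+t) ≤ C(N, ⌈N/2⌉+i) * exp((i² - t²)/N)`. -/
theorem permutation_complex_binom_exp_bound (N t i : ℕ) (hN : 1 ≤ N) (hi : i ≤ t)
    (ht : 2 * t ≤ N) :
    (N.choose ((N + 1) / 2 + t) : ℝ)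
      ≤ (N.choose ((N + 1) / 2 + i) : ℝ) *
          Real.exp (((i : ℝ) ^ 2 - (t : ℝ) ^ 2) / (N : ℝ)) := by
  induction t, hi using Nat.le_induction with
  | base => simp
  | succ k _ ih =>
    calc (N.choose ((N + 1) / 2 + (k + 1)) : ℝ)
        ≤ N.choose ((N + 1) / 2 + k) * Real.exp (-(2 * k + 1) / N) :=
          choose_half_add_succ_le N k ht
      _ ≤ N.choose ((N + 1) / 2 + i) * Real.exp (((i : ℝ) ^ 2 - (k : ℝ) ^ 2) / N) *
            Real.exp (-(2 * k + 1) / N) := by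
          gcongr
          exact ih (by omega)
      _ = N.choose ((N + 1) / 2 + i) *
            Real.exp (((i : ℝ) ^ 2 - ((k + 1 : ℕ) : ℝ) ^ 2) / N) := by
          rw [mul_assoc, ← Real.exp_add, ← add_div]
          push_cast
          ring_nf
end

section
/- For all integers $N \ge 1$ and $t \ge 1$, $\sum_{i=0}^{t-1} \exp\!\left(\frac{i^2}{N}\right) \le \frac{N}{t}\left(\exp\!\left(\frac{t^2}{N}\right) - 1\right)$. -/
/-- A geometric sum of exponentials is bounded by the corresponding integral. -/
theorem mul_sum_exp_mul_le (x : ℝ) (n : ℕ) :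
    x * ∑ i ∈ Finset.range n, Real.exp (i * x) ≤ Real.exp (n * x) - 1 := by
  have h : ∑ i ∈ Finset.range n, (Real.exp ((i + 1 : ℕ) * x) - Real.exp (i * x)) =
      Real.exp (n * x) - 1 := by
    simpa using Finset.sum_range_sub (fun i : ℕ => Real.exp (i * x)) n
  rw [← h, Finset.mul_sum]
  refine Finset.sum_le_sum fun i _ => ?_
  have hexp : Real.exp ((i + 1 : ℕ) * x) = Real.exp (i * x) * Real.exp x := by
    rw [← Real.exp_add]
    push_cast
    ring_nf
  rw [hexp]
  nlinarith [Real.exp_pos (i * x), Real.add_one_le_exp x]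

/-- Inequality (3) from Claim 2.2: for `N ≥ 1`, `t ≥ 1`,
`∑_{i=0}^{t-1} exp(i²/N) ≤ (N/t)(exp(t²/N) - 1)`. -/
theorem permutation_complex_exp_sum_bound (N t : ℕ) (hN : 1 ≤ N) (ht : 1 ≤ t) :
    ∑ i ∈ Finset.range t, Real.exp ((i : ℝ) ^ 2 / (N : ℝ))
      ≤ (N : ℝ) / (t : ℝ) * (Real.exp ((t : ℝ) ^ 2 / (N : ℝ)) - 1) := by
  have hN' : (0 : ℝ) < N := by exact_mod_cast hN
  have ht' : (0 : ℝ) < t := by exact_mod_cast ht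
  calc ∑ i ∈ Finset.range t, Real.exp ((i : ℝ) ^ 2 / (N : ℝ))
      ≤ ∑ i ∈ Finset.range t, Real.exp (i * ((t : ℝ) / N)) := by
        refine Finset.sum_le_sum fun i hi => ?_
        have hit : (i : ℝ) ≤ t := by exact_mod_cast (Finset.mem_range.mp hi).le
        rw [sq, mul_div_assoc]
        gcongr
    _ = (N : ℝ) / t * ((t : ℝ) / N * ∑ i ∈ Finset.range t, Real.exp (i * ((t : ℝ) / N))) := by
        rw [← mul_assoc, div_mul_div_cancel₀ ht'.ne', div_self hN'.ne', one_mul]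
    _ ≤ (N : ℝ) / t * (Real.exp (t * ((t : ℝ) / N)) - 1) := by
        gcongr
        exact mul_sum_exp_mul_le _ _
    _ = (N : ℝ) / t * (Real.exp ((t : ℝ) ^ 2 / N) - 1) := by
        rw [sq, mul_div_assoc]
end

section
/- For all integers $\beta_1, \beta_2, \beta_3 \ge 0$, $2\int_{Q_2} (1-u-v)^{\beta_1}(1-u)^{\beta_2}(u+v)^{\beta_3}\, du\, dv \le \frac{2\, \beta_1!\, \beta_3!}{(\beta_2+1)(\beta_1+\beta_3+1)!}$, where the integral is with respect to two-dimensional Lebesgue measure on $Q_2$. -/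
open MeasureTheory

theorem integral_pow_mul_one_sub_pow_eq_factorial (m n : ℕ) :
    ∫ x : ℝ in 0..1, x ^ m * (1 - x) ^ n =
      (m.factorial : ℝ) * n.factorial / (m + n + 1).factorial := by
  have h := Complex.betaIntegral_eq_Gamma_mul_div ((m : ℂ) + 1) ((n : ℂ) + 1)
    (by simp; positivity) (by simp; positivity)
  rw [show (m : ℂ) + 1 + (n + 1) = ((m + n + 1 : ℕ) : ℂ) + 1 by push_cast; ring] at h
  simp only [Complex.betaIntegral, Complex.Gamma_nat_eq_factorial, add_sub_cancel_right,
    Complex.cpow_natCast] at h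
  apply Complex.ofReal_injective
  rw [← intervalIntegral.integral_ofReal]
  push_cast
  exact h

theorem setIntegral_add_le_one_eq_setIntegral_shear (g : ℝ × ℝ → ℝ) :
    ∫ p in {p : ℝ × ℝ | 0 ≤ p.1 ∧ 0 ≤ p.2 ∧ p.1 + p.2 ≤ 1}, g (p.1, p.1 + p.2) =
      ∫ q in {q : ℝ × ℝ | 0 ≤ q.1 ∧ q.1 ≤ q.2 ∧ q.2 ≤ 1}, g q := by
  have h := (measurePreserving_prod_add (volume : Measure ℝ) volume).setIntegral_preimage_emb
    (MeasurableEquiv.shearAddRight ℝ).measurableEmbedding g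
    {q : ℝ × ℝ | 0 ≤ q.1 ∧ q.1 ≤ q.2 ∧ q.2 ≤ 1}
  simpa [Set.preimage, Measure.volume_eq_prod] using h

/-- Claim 2.4: for integers `β₁, β₂, β₃ ≥ 0`,
`2 ∫_{Q₂} (1-u-v)^{β₁} (1-u)^{β₂} (u+v)^{β₃} du dv ≤ 2 β₁! β₃! / ((β₂+1)(β₁+β₃+1)!)`,
where `Q₂ = {(u,v) : u ≥ 0, v ≥ 0, u+v ≤ 1}` with two-dimensional Lebesgue measure. -/
theorem permutation_complex_claim_intc1 (β₁ β₂ β₃ : ℕ) :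
    2 * (∫ p in {p : ℝ × ℝ | 0 ≤ p.1 ∧ 0 ≤ p.2 ∧ p.1 + p.2 ≤ 1},
          (1 - p.1 - p.2) ^ β₁ * (1 - p.1) ^ β₂ * (p.1 + p.2) ^ β₃)
      ≤ 2 * (Nat.factorial β₁ : ℝ) * (Nat.factorial β₃ : ℝ) /
          (((β₂ : ℝ) + 1) * (Nat.factorial (β₁ + β₃ + 1) : ℝ)) := by
  let g : ℝ × ℝ → ℝ := fun q => (1 - q.1) ^ β₂ * (q.2 ^ β₃ * (1 - q.2) ^ β₁)
  have hshear : ∫ p in {p : ℝ × ℝ | 0 ≤ p.1 ∧ 0 ≤ p.2 ∧ p.1 + p.2 ≤ 1},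
      (1 - p.1 - p.2) ^ β₁ * (1 - p.1) ^ β₂ * (p.1 + p.2) ^ β₃ =
      ∫ q in {q : ℝ × ℝ | 0 ≤ q.1 ∧ q.1 ≤ q.2 ∧ q.2 ≤ 1}, g q := by
    rw [← setIntegral_add_le_one_eq_setIntegral_shear]
    congr 1 with p
    simp only [g]
    ring
  have hle : ∫ q in {q : ℝ × ℝ | 0 ≤ q.1 ∧ q.1 ≤ q.2 ∧ q.2 ≤ 1}, g q ≤
      ∫ q in Set.Icc (0 : ℝ) 1 ×ˢ Set.Icc (0 : ℝ) 1, g q := by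
    refine setIntegral_mono_set ?_ ?_ (Filter.Eventually.of_forall ?_)
    · exact (by fun_prop : Continuous g).continuousOn.integrableOn_compact
        (isCompact_Icc.prod isCompact_Icc)
    · refine ae_restrict_of_forall_mem (measurableSet_Icc.prod measurableSet_Icc) ?_
      rintro ⟨u, s⟩ ⟨⟨_, hu⟩, hs₀, hs₁⟩
      have hu' := sub_nonneg.2 hu
      have hs' := sub_nonneg.2 hs₁
      simp only [Pi.zero_apply, g] at *
      positivity
    · rintro ⟨u, s⟩ ⟨h₀, h₁, h₂⟩
      exact ⟨⟨h₀, h₁.trans h₂⟩, h₀.trans h₁, h₂⟩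
  have hfst : ∫ u : ℝ in Set.Icc 0 1, (1 - u) ^ β₂ = 1 / ((β₂ : ℝ) + 1) := by
    have h := integral_pow_mul_one_sub_pow_eq_factorial 0 β₂
    rw [integral_Icc_eq_integral_Ioc, ← intervalIntegral.integral_of_le zero_le_one]
    simp only [pow_zero, one_mul, zero_add, Nat.factorial_zero, Nat.cast_one] at h
    rw [h, Nat.factorial_succ]
    push_cast
    field_simp
  have hsnd : ∫ s : ℝ in Set.Icc 0 1, s ^ β₃ * (1 - s) ^ β₁ =
      (β₃.factorial : ℝ) * β₁.factorial / (β₁ + β₃ + 1).factorial := by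
    rw [integral_Icc_eq_integral_Ioc, ← intervalIntegral.integral_of_le zero_le_one,
      integral_pow_mul_one_sub_pow_eq_factorial, add_comm β₃ β₁]
  rw [Measure.volume_eq_prod, setIntegral_prod_mul (fun u : ℝ => (1 - u) ^ β₂)
    (fun s : ℝ => s ^ β₃ * (1 - s) ^ β₁), hfst, hsnd, ← Measure.volume_eq_prod] at hle
  rw [hshear]
  calc _ ≤ 2 * _ := mul_le_mul_of_nonneg_left hle zero_le_two
    _ = _ := by field_simp
end

section
/- For all integers $k \ge 0$ and $\ell \ge 0$, define $I(k,\ell) = 4\int_{Q_2 \times Q_2} \big(x_1(1-u-v) + x_2(1-u) + (1-x_1-x_2)(u+v)\big)^k \big((1-x_1-x_2)(1-u-v)\big)^{\ell}\, dx_1\, dx_2\, du\, dv$ (Lebesgue measure on $Q_2 \times Q_2 \subset \mathbb{R}^4$). Then $I(k,\ell) \le \frac{40}{k+2}\binom{k+\ell+2}{2}^{-1}\binom{k+\ell}{k}^{-1}\big(1 + \log(k+1)\big)$. -/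
open MeasureTheory

theorem integral_pow_mul_one_sub_pow (p q : ℕ) :
    ∫ x in (0 : ℝ)..1, x ^ p * (1 - x) ^ q =
      (p.factorial * q.factorial : ℝ) / (p + q + 1).factorial := by
  induction q generalizing p with
  | zero =>
    have : (p.factorial : ℝ) ≠ 0 := by positivity
    simp [integral_pow, Nat.factorial_succ]
    field_simp
  | succ q ih =>
    have hu (x : ℝ) : HasDerivAt (fun x : ℝ => x ^ (p + 1) / (p + 1)) (x ^ p) x := by
      refine ((hasDerivAt_pow (p + 1) x).div_const ((p : ℝ) + 1)).congr_deriv ?_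
      have : (p : ℝ) + 1 ≠ 0 := by positivity
      push_cast
      field_simp
    have hv (x : ℝ) : HasDerivAt (fun x : ℝ => (1 - x) ^ (q + 1)) (-((q + 1) * (1 - x) ^ q)) x := by
      refine (((hasDerivAt_id' x).const_sub 1).fun_pow (q + 1)).congr_deriv ?_
      push_cast
      ring
    have h := intervalIntegral.integral_deriv_mul_eq_sub (a := 0) (b := 1)
      (fun x _ => hu x) (fun x _ => hv x)
      (Continuous.intervalIntegrable (by fun_prop) _ _)
      (Continuous.intervalIntegrable (by fun_prop) _ _)
    rw [intervalIntegral.integral_add (Continuous.intervalIntegrable (by fun_prop) _ _)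
      (Continuous.intervalIntegrable (by fun_prop) _ _)] at h
    have h2 : ∫ x in (0 : ℝ)..1, x ^ (p + 1) / (p + 1) * -((q + 1) * (1 - x) ^ q) =
        -((q + 1) / (p + 1)) * ∫ x in (0 : ℝ)..1, x ^ (p + 1) * (1 - x) ^ q := by
      rw [← intervalIntegral.integral_const_mul]
      congr 1 with x
      ring
    rw [h2, ih (p + 1)] at h
    have h3 : p + 1 + q + 1 = p + (q + 1) + 1 := by ring
    rw [h3] at h
    simp only [sub_self, zero_pow (Nat.succ_ne_zero _), mul_zero, zero_div, zero_mul] at h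
    rw [Nat.factorial_succ p] at h
    rw [Nat.factorial_succ q]
    push_cast at h ⊢
    have : (0 : ℝ) < p + 1 := by positivity
    field_simp at h ⊢
    linarith

/-- The triangle `{(x, y) : x ≥ 0, y ≥ 0, x + y ≤ 1}`. -/
def triangle : Set (ℝ × ℝ) := {z | 0 ≤ z.1 ∧ 0 ≤ z.2 ∧ z.1 + z.2 ≤ 1}

theorem measurableSet_triangle : MeasurableSet triangle := by
  unfold triangle
  measurability

theorem setIntegral_triangle (p q i : ℕ) :
    ∫ z in triangle, (1 - z.1 - z.2) ^ p * (z.1 + z.2) ^ q * z.2 ^ i =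
      (p.factorial * (q + i + 1).factorial : ℝ) / ((p + q + i + 2).factorial * (i + 1)) := by
  set T : Set (ℝ × ℝ) := {z | 0 ≤ z.1 ∧ z.1 ≤ z.2 ∧ z.2 ≤ 1} with hT
  have hTm : MeasurableSet T := by rw [hT]; measurability
  set g : ℝ × ℝ → ℝ := fun z => (1 - z.2) ^ p * z.2 ^ q * (z.2 - z.1) ^ i with hg
  have hmp : MeasurePreserving (MeasurableEquiv.shearAddRight ℝ) volume volume :=
    measurePreserving_prod_add volume volume
  have h1 := hmp.setIntegral_preimage_emb (MeasurableEquiv.measurableEmbedding _) g T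
  have h2 : (MeasurableEquiv.shearAddRight ℝ) ⁻¹' T = triangle := by
    ext z
    simp [hT, triangle, MeasurableEquiv.shearAddRight]
  rw [h2] at h1
  have h3 : ∀ z : ℝ × ℝ, g (MeasurableEquiv.shearAddRight ℝ z) =
      (1 - z.1 - z.2) ^ p * (z.1 + z.2) ^ q * z.2 ^ i := by
    intro z
    simp [hg, MeasurableEquiv.shearAddRight, sub_sub]
  simp only [h3] at h1
  rw [h1, ← integral_indicator hTm]
  have hgi : Integrable (T.indicator g) volume := by
    rw [integrable_indicator_iff hTm]
    refine (Continuous.integrableOn_Icc (a := ((0, 0) : ℝ × ℝ)) (b := (1, 1)) ?_).mono_set ?_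
    · rw [hg]; fun_prop
    · rintro ⟨x, w⟩ ⟨ha, hb, hc⟩
      simp only at ha hb hc
      refine ⟨⟨ha, ?_⟩, ⟨?_, hc⟩⟩ <;> simp only <;> linarith
  rw [Measure.volume_eq_prod, integral_prod_symm _ hgi]
  have h4 : ∀ w : ℝ, ∫ x, T.indicator g (x, w) =
      (Set.Icc (0 : ℝ) 1).indicator (fun w => w ^ (q + i + 1) * (1 - w) ^ p / (i + 1)) w := by
    intro w
    by_cases hw : w ∈ Set.Icc (0 : ℝ) 1
    · rw [Set.indicator_of_mem hw]
      have h5 : (fun x => T.indicator g (x, w)) = (Set.Icc 0 w).indicator (fun x => g (x, w)) := by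
        ext x
        simp only [Set.indicator_apply, hT, Set.mem_ofPred_eq, Set.mem_Icc, hw.2, and_true]
      rw [h5, integral_indicator measurableSet_Icc, integral_Icc_eq_integral_Ioc,
        ← intervalIntegral.integral_of_le hw.1]
      simp only [hg]
      rw [intervalIntegral.integral_const_mul,
        intervalIntegral.integral_comp_sub_left (fun x => x ^ i) w]
      simp only [sub_self, sub_zero, integral_pow]
      simp
      ring
    · rw [Set.indicator_of_notMem hw]
      have h5 : (fun x => T.indicator g (x, w)) = 0 := by
        ext x
        refine Set.indicator_of_notMem ?_ _
        rintro ⟨ha, hb, hc⟩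
        exact hw ⟨ha.trans hb, hc⟩
      rw [h5]; simp
  simp only [h4]
  rw [integral_indicator measurableSet_Icc, integral_Icc_eq_integral_Ioc,
    ← intervalIntegral.integral_of_le zero_le_one, intervalIntegral.integral_div,
    integral_pow_mul_one_sub_pow]
  rw [show q + i + 1 + p + 1 = p + q + i + 2 by ring, div_div, mul_comm (p.factorial : ℝ)]

theorem sum_range_choose_mul_choose (n l j : ℕ) :
    ∑ r ∈ Finset.range (n + 1), (l + r).choose l * (n - r).choose j =
      (n + l + 1).choose (l + j + 1) := by
  induction n generalizing j with
  | zero =>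
    cases j with
    | zero => simp
    | succ j => simp [Nat.choose_eq_zero_of_lt (show l + 1 < l + (j + 1) + 1 by lia)]
  | succ n ih =>
    cases j with
    | zero =>
      have h0 := ih 0
      simp only [Nat.choose_zero_right, mul_one, add_zero] at h0 ⊢
      rw [Finset.sum_range_succ, h0, show n + 1 + l + 1 = (n + l + 1) + 1 by ring,
        Nat.choose_succ_succ (n + l + 1) l, show l + (n + 1) = n + l + 1 by ring, add_comm]
    | succ j =>
      rw [Finset.sum_range_succ]
      have h : ∀ r ∈ Finset.range (n + 1), (l + r).choose l * (n + 1 - r).choose (j + 1) =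
          (l + r).choose l * (n - r).choose j + (l + r).choose l * (n - r).choose (j + 1) := by
        intro r hr
        rw [Finset.mem_range] at hr
        rw [show n + 1 - r = (n - r) + 1 by lia, Nat.choose_succ_succ, mul_add]
      rw [Finset.sum_congr rfl h, Finset.sum_add_distrib, ih, ih,
        show n + 1 + l + 1 = (n + l + 1) + 1 by ring,
        show l + (j + 1) + 1 = (l + j + 1) + 1 by ring, Nat.choose_succ_succ (n + l + 1)]
      simp

theorem sum_choose_mul_choose_succ_div_le (k l j : ℕ) (hj : j < k) :
    ∑ r ∈ Finset.range (k - (j + 1) + 1),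
      ((l + r).choose l : ℝ) * (l + (j + 1)).choose l * (k + 1 - r).choose (j + 1) /
        ((k + 1).choose (j + 1) * ((k - (j + 1) - r : ℕ) + 1)) ≤
      2 * (k + l + 2).choose l * (((j : ℝ) + 1)⁻¹ + ((k - j : ℕ) + 1 : ℝ)⁻¹) := by
  have hc : (0 : ℝ) < (k + 1).choose (j + 1) := by
    exact_mod_cast Nat.choose_pos (by lia)
  have hterm : ∀ r ∈ Finset.range (k - (j + 1) + 1),
      ((l + r).choose l : ℝ) * (l + (j + 1)).choose l * (k + 1 - r).choose (j + 1) /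
        ((k + 1).choose (j + 1) * ((k - (j + 1) - r : ℕ) + 1)) ≤
      2 * (l + (j + 1)).choose l / ((k + 1).choose (j + 1) * (j + 1)) *
        ((l + r).choose l * (k + 1 - r).choose j) := by
    intro r hr
    rw [Finset.mem_range] at hr
    obtain ⟨i, hi⟩ : ∃ i, k = i + (j + 1) + r := ⟨k - (j + 1) - r, by lia⟩
    have h := Nat.choose_succ_right_eq (k + 1 - r) j
    rw [show k + 1 - r - j = i + 2 by lia] at h
    have h' : ((k + 1 - r).choose (j + 1) : ℝ) * (j + 1) = (k + 1 - r).choose j * (i + 2) := by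
      exact_mod_cast h
    rw [show k - (j + 1) - r = i by lia]
    have h2 : ((k + 1 - r).choose (j + 1) : ℝ) / (i + 1) ≤
        2 * (k + 1 - r).choose j / (j + 1) := by
      rw [div_le_div_iff₀ (by positivity) (by positivity), h']
      have : (0 : ℝ) ≤ (k + 1 - r).choose j := by positivity
      have : (0 : ℝ) ≤ i := by positivity
      nlinarith
    calc _ = ((l + r).choose l : ℝ) * (l + (j + 1)).choose l / (k + 1).choose (j + 1) *
          ((k + 1 - r).choose (j + 1) / (i + 1)) := by field_simp
      _ ≤ ((l + r).choose l : ℝ) * (l + (j + 1)).choose l / (k + 1).choose (j + 1) *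
          (2 * (k + 1 - r).choose j / (j + 1)) := by gcongr
      _ = _ := by field_simp
  have hsum : ∑ r ∈ Finset.range (k - (j + 1) + 1),
      ((l + r).choose l * (k + 1 - r).choose j : ℝ) ≤ (k + l + 2).choose (l + j + 1) := by
    have h := sum_range_choose_mul_choose (k + 1) l j
    rw [show k + 1 + l + 1 = k + l + 2 by ring] at h
    rw [← h]
    push_cast
    refine Finset.sum_le_sum_of_subset_of_nonneg ?_ fun _ _ _ => by positivity
    exact Finset.range_subset_range.2 (by lia)
  have hprod : ((l + (j + 1)).choose l : ℝ) * (k + l + 2).choose (l + j + 1) =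
      (k + l + 2).choose l * (k + 2).choose (j + 1) := by
    have h := Nat.choose_mul (n := k + l + 2) (k := l + j + 1) (s := l) (by lia)
    rw [show k + l + 2 - l = k + 2 by lia, show l + j + 1 - l = j + 1 by lia] at h
    rw [mul_comm]
    exact_mod_cast h
  have hratio : ((k + 1).choose (j + 1) : ℝ) * (k + 2) =
      (k + 2).choose (j + 1) * ((k - j : ℕ) + 1) := by
    have h := Nat.choose_mul_succ_eq (k + 1) (j + 1)
    rw [show k + 1 + 1 - (j + 1) = k - j + 1 by lia] at h
    exact_mod_cast h
  refine (Finset.sum_le_sum hterm).trans ?_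
  rw [← Finset.mul_sum]
  calc _ ≤ 2 * ((l + (j + 1)).choose l : ℝ) / ((k + 1).choose (j + 1) * (j + 1)) *
        (k + l + 2).choose (l + j + 1) := by gcongr
    _ = 2 * (((l + (j + 1)).choose l : ℝ) * (k + l + 2).choose (l + j + 1)) /
        ((k + 1).choose (j + 1) * (j + 1)) := by ring
    _ = 2 * (k + l + 2).choose l * ((k + 2) / ((j + 1) * ((k - j : ℕ) + 1))) := by
      rw [hprod, ← mul_assoc, mul_div_assoc]
      congr 1
      rw [div_eq_div_iff (by positivity) (by positivity)]
      linear_combination (-(j : ℝ) - 1) * hratio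
    _ = _ := by
      congr 1
      rw [Nat.cast_sub hj.le]
      have : (0 : ℝ) < k - j + 1 := by
        have : (j : ℝ) < k := by exact_mod_cast hj
        linarith
      field_simp
      ring

theorem sum_choose_zero_div_le (k l : ℕ) :
    ∑ r ∈ Finset.range (k + 1), ((l + r).choose l : ℝ) / ((k - r : ℕ) + 1) ≤
      (k + l + 2).choose l * harmonic (k + 1) := by
  rw [harmonic, ← Finset.sum_range_reflect]
  push_cast
  rw [Finset.mul_sum]
  refine Finset.sum_le_sum fun r hr => ?_
  rw [Finset.mem_range] at hr
  rw [show k - (k - r) = r by lia, div_eq_mul_inv]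
  have h : (l + (k - r)).choose l ≤ (k + l + 2).choose l := Nat.choose_le_choose l (by lia)
  gcongr

theorem sum_sum_choose_div_le (k l : ℕ) :
    ∑ j ∈ Finset.range (k + 1), ∑ r ∈ Finset.range (k - j + 1),
      ((l + r).choose l : ℝ) * (l + j).choose l * (k + 1 - r).choose j /
        ((k + 1).choose j * ((k - j - r : ℕ) + 1)) ≤
      5 * (k + l + 2).choose l * harmonic (k + 1) := by
  have hH : (harmonic (k + 1) : ℝ) = ∑ j ∈ Finset.range (k + 1), ((j : ℝ) + 1)⁻¹ := by
    simp [harmonic]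
  have h1 : ∑ j ∈ Finset.range k, ((j : ℝ) + 1)⁻¹ ≤ harmonic (k + 1) := by
    rw [hH]
    exact Finset.sum_le_sum_of_subset_of_nonneg (Finset.range_subset_range.2 (by lia))
      fun _ _ _ => by positivity
  have h2 : ∑ j ∈ Finset.range k, ((k - j : ℕ) + 1 : ℝ)⁻¹ ≤ harmonic (k + 1) := by
    rw [hH, ← Finset.sum_range_reflect _ (k + 1)]
    simp only [Nat.add_sub_cancel]
    exact Finset.sum_le_sum_of_subset_of_nonneg (Finset.range_subset_range.2 (by lia))
      fun _ _ _ => by positivity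
  rw [Finset.sum_range_succ']
  have h3 := Finset.sum_le_sum fun j hj =>
    sum_choose_mul_choose_succ_div_le k l j (Finset.mem_range.1 hj)
  rw [← Finset.mul_sum, Finset.sum_add_distrib] at h3
  have h4 := sum_choose_zero_div_le k l
  have h5 : 2 * ((k + l + 2).choose l : ℝ) * (∑ j ∈ Finset.range k, ((j : ℝ) + 1)⁻¹ +
      ∑ j ∈ Finset.range k, ((k - j : ℕ) + 1 : ℝ)⁻¹) ≤
      2 * ((k + l + 2).choose l : ℝ) * (harmonic (k + 1) + harmonic (k + 1)) := by gcongr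
  simp only [add_zero, Nat.choose_self, Nat.choose_zero_right, Nat.sub_zero, Nat.cast_one,
    mul_one, one_mul]
  linarith

theorem mul_choose_factorial_eq (l j r i : ℕ) :
    (((j + r + i).choose j : ℝ) * (r + i).choose r) *
      (((l + r).factorial * (j + i + 1).factorial : ℝ) /
          ((l + r + j + i + 2).factorial * (i + 1)) *
        ((l + j).factorial * (r + i + 1).factorial /
          ((l + j + r + i + 2).factorial * (i + 1)))) =
    (j + r + i).factorial * (j + r + i + 1).factorial * (l.factorial : ℝ) ^ 2 /
        ((j + r + i + l + 2).factorial : ℝ) ^ 2 *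
      (((l + r).choose l : ℝ) * (l + j).choose l * (j + i + 1).choose j /
        ((j + r + i + 1).choose j * (i + 1))) := by
  rw [show l + r + j + i + 2 = j + r + i + l + 2 by ring,
    show l + j + r + i + 2 = j + r + i + l + 2 by ring, show j + r + i = j + (r + i) by ring,
    show j + i + 1 = j + (i + 1) by ring, show j + (r + i) + 1 = j + (r + i + 1) by ring]
  simp only [Nat.cast_add_choose]
  rw [Nat.factorial_succ i]
  push_cast
  field_simp

theorem setIntegral_triangle_prod (k l : ℕ) :
    ∫ p in triangle ×ˢ triangle,
          (p.1.1 * (1 - p.2.1 - p.2.2) + p.1.2 * (1 - p.2.1) +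
              (1 - p.1.1 - p.1.2) * (p.2.1 + p.2.2)) ^ k *
            ((1 - p.1.1 - p.1.2) * (1 - p.2.1 - p.2.2)) ^ l =
    k.factorial * (k + 1).factorial * (l.factorial : ℝ) ^ 2 / ((k + l + 2).factorial : ℝ) ^ 2 *
      ∑ j ∈ Finset.range (k + 1), ∑ r ∈ Finset.range (k - j + 1),
      ((l + r).choose l : ℝ) * (l + j).choose l * (k + 1 - r).choose j /
        ((k + 1).choose j * ((k - j - r : ℕ) + 1)) := by
  have hexp (p : (ℝ × ℝ) × (ℝ × ℝ)) :
      (p.1.1 * (1 - p.2.1 - p.2.2) + p.1.2 * (1 - p.2.1) +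
              (1 - p.1.1 - p.1.2) * (p.2.1 + p.2.2)) ^ k *
            ((1 - p.1.1 - p.1.2) * (1 - p.2.1 - p.2.2)) ^ l =
      ∑ j ∈ Finset.range (k + 1), ∑ r ∈ Finset.range (k - j + 1),
        ((k.choose j : ℝ) * (k - j).choose r) *
        (((1 - p.1.1 - p.1.2) ^ (l + r) * (p.1.1 + p.1.2) ^ j * p.1.2 ^ (k - j - r)) *
        ((1 - p.2.1 - p.2.2) ^ (l + j) * (p.2.1 + p.2.2) ^ r * p.2.2 ^ (k - j - r))) := by
    rw [show p.1.1 * (1 - p.2.1 - p.2.2) + p.1.2 * (1 - p.2.1) +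
              (1 - p.1.1 - p.1.2) * (p.2.1 + p.2.2) =
        (p.1.1 + p.1.2) * (1 - p.2.1 - p.2.2) +
          ((1 - p.1.1 - p.1.2) * (p.2.1 + p.2.2) + p.1.2 * p.2.2) by ring,
      add_pow, Finset.sum_mul]
    refine Finset.sum_congr rfl fun j _ => ?_
    rw [add_pow, Finset.mul_sum, Finset.sum_mul, Finset.sum_mul]
    refine Finset.sum_congr rfl fun r _ => ?_
    simp only [mul_pow, pow_add]
    ring
  have hint (c : ℝ) (a b i a' b' i' : ℕ) : IntegrableOn (fun p : (ℝ × ℝ) × (ℝ × ℝ) => c *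
        (((1 - p.1.1 - p.1.2) ^ a * (p.1.1 + p.1.2) ^ b * p.1.2 ^ i) *
        ((1 - p.2.1 - p.2.2) ^ a' * (p.2.1 + p.2.2) ^ b' * p.2.2 ^ i')))
        (triangle ×ˢ triangle) := by
    refine (Continuous.integrableOn_Icc (a := (((0, 0), (0, 0)) : (ℝ × ℝ) × (ℝ × ℝ)))
      (b := ((1, 1), (1, 1))) (by fun_prop)).mono_set ?_
    rintro ⟨⟨x, y⟩, ⟨u, v⟩⟩ ⟨⟨h1, h2, h3⟩, ⟨h4, h5, h6⟩⟩
    simp only at h1 h2 h3 h4 h5 h6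
    refine ⟨⟨⟨h1, h2⟩, ⟨h4, h5⟩⟩, ⟨⟨?_, ?_⟩, ⟨?_, ?_⟩⟩⟩ <;> simp only <;> linarith
  simp only [hexp]
  rw [integral_finsetSum _ fun j _ => integrable_finsetSum _ fun r _ => hint _ _ _ _ _ _ _,
    Finset.mul_sum]
  refine Finset.sum_congr rfl fun j hj => ?_
  rw [integral_finsetSum _ fun r _ => hint _ _ _ _ _ _ _, Finset.mul_sum]
  refine Finset.sum_congr rfl fun r hr => ?_
  rw [Finset.mem_range] at hj hr
  obtain ⟨i, rfl⟩ : ∃ i, k = j + r + i := ⟨k - j - r, by lia⟩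
  rw [integral_const_mul, Measure.volume_eq_prod,
    setIntegral_prod_mul
      (fun z : ℝ × ℝ => (1 - z.1 - z.2) ^ (l + r) * (z.1 + z.2) ^ j * z.2 ^ (j + r + i - j - r))
      (fun z : ℝ × ℝ => (1 - z.1 - z.2) ^ (l + j) * (z.1 + z.2) ^ r * z.2 ^ (j + r + i - j - r)),
    setIntegral_triangle, setIntegral_triangle, show j + r + i - j - r = i by lia,
    show j + r + i - j = r + i by lia, show j + r + i + 1 - r = j + i + 1 by lia]
  exact mul_choose_factorial_eq l j r i

/-- Proposition 2.1 (the key estimate): for `k, ℓ ≥ 0`,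
`I(k,ℓ) = 4 ∫_{Q₂×Q₂} (x₁(1-u-v) + x₂(1-u) + (1-x₁-x₂)(u+v))^k ((1-x₁-x₂)(1-u-v))^ℓ`
satisfies `I(k,ℓ) ≤ (40/(k+2)) C(k+ℓ+2,2)⁻¹ C(k+ℓ,k)⁻¹ (1 + log(k+1))`. -/
theorem permutation_complex_key_estimate (k ℓ : ℕ) :
    4 * (∫ p in {p : (ℝ × ℝ) × (ℝ × ℝ) |
            (0 ≤ p.1.1 ∧ 0 ≤ p.1.2 ∧ p.1.1 + p.1.2 ≤ 1) ∧
            (0 ≤ p.2.1 ∧ 0 ≤ p.2.2 ∧ p.2.1 + p.2.2 ≤ 1)},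
          (p.1.1 * (1 - p.2.1 - p.2.2) + p.1.2 * (1 - p.2.1) +
              (1 - p.1.1 - p.1.2) * (p.2.1 + p.2.2)) ^ k *
            ((1 - p.1.1 - p.1.2) * (1 - p.2.1 - p.2.2)) ^ ℓ)
      ≤ 40 / ((k : ℝ) + 2) * (((k + ℓ + 2).choose 2 : ℝ))⁻¹ *
          (((k + ℓ).choose k : ℝ))⁻¹ * (1 + Real.log ((k : ℝ) + 1)) := by
  have hset : {p : (ℝ × ℝ) × (ℝ × ℝ) |
            (0 ≤ p.1.1 ∧ 0 ≤ p.1.2 ∧ p.1.1 + p.1.2 ≤ 1) ∧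
            (0 ≤ p.2.1 ∧ 0 ≤ p.2.2 ∧ p.2.1 + p.2.2 ≤ 1)} = triangle ×ˢ triangle := rfl
  rw [hset, setIntegral_triangle_prod]
  have hlog : (harmonic (k + 1) : ℝ) ≤ 1 + Real.log ((k : ℝ) + 1) := by
    exact_mod_cast harmonic_le_one_add_log (k + 1)
  have hpos : 0 ≤ 1 + Real.log ((k : ℝ) + 1) :=
    add_nonneg zero_le_one (Real.log_nonneg (by simp))
  have hsum := (sum_sum_choose_div_le k ℓ).trans (mul_le_mul_of_nonneg_left hlog (by positivity))
  have hC : ((k + ℓ + 2).choose ℓ : ℝ) =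
      (k + ℓ + 2).factorial / (ℓ.factorial * (k + 2).factorial) := by
    rw [show k + ℓ + 2 = ℓ + (k + 2) by ring, Nat.cast_add_choose]
  have hfac : ((k + ℓ + 2).factorial : ℝ) = (k + ℓ + 2) * ((k + ℓ + 1) * (k + ℓ).factorial) := by
    rw [Nat.factorial_succ, Nat.factorial_succ]
    push_cast
    ring
  have hchoose2 : ((k + ℓ + 2).choose 2 : ℝ) = (k + ℓ + 2) * (k + ℓ + 1) / 2 := by
    rw [Nat.cast_choose_two]
    push_cast
    ring
  calc _ ≤ 4 * (k.factorial * (k + 1).factorial * (ℓ.factorial : ℝ) ^ 2 /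
        ((k + ℓ + 2).factorial : ℝ) ^ 2 *
        (5 * (k + ℓ + 2).choose ℓ * (1 + Real.log ((k : ℝ) + 1)))) := by gcongr
    _ = 10 / ((k : ℝ) + 2) * (((k + ℓ + 2).choose 2 : ℝ))⁻¹ *
          (((k + ℓ).choose k : ℝ))⁻¹ * (1 + Real.log ((k : ℝ) + 1)) := by
      rw [hC, hchoose2, Nat.cast_add_choose, hfac, Nat.factorial_succ (k + 1)]
      push_cast
      field_simp
      ring
    _ ≤ _ := by
      gcongr
      norm_num
end
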